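/- Let β > β_c and h = 0, and let μ̂ := lim_{m→∞} μ_{β,0}^+( · | η(i,0) = −1 for all i ∈ {−m,…,−1} ) (this weak limit exists by monotonicity). Then μ̂ is trivial on the tail σ-algebra of {−1,+1}^{ℤ²}: every event in ⋂_{N≥1} σ( η(x) : x ∈ ℤ² \ [−N,N]² ) has μ̂-measure 0 or 1. -/

import Mathlib

open MeasureTheory Filter Topology ProbabilityTheory

noncomputable section

/-- Spin value of a Boolean spin: `true ↦ +1`, `false ↦ -1`. -/
def sval (b : Bool) : ℝ := if b then 1 else -1

/-- Two-dimensional spin configurations. -/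
abbrev Cfg2 := ℤ × ℤ → Bool

/-- Two-sided sequences over an alphabet `A`. -/
abbrev ZSeq (A : Type*) := ℤ → A

/-- Pasts: index `k` corresponds to the coordinate `-(k+1)`. -/
abbrev Past (A : Type*) := ℕ → A

/-- The four nearest neighbours of a site of `ℤ²`. -/
def nbrs (x : ℤ × ℤ) : Finset (ℤ × ℤ) :=
  {(x.1 + 1, x.2), (x.1 - 1, x.2), (x.1, x.2 + 1), (x.1, x.2 - 1)}

/-- Boltzmann weight
`exp(β[Σ_{{x,y}⊆Λ, x∼y} ω_x ω_y + Σ_{x∈Λ, y∉Λ, x∼y} ω_x σ_y] − h Σ_{x∈Λ} ω_x)`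
(the sum over unordered pairs inside `Λ` is written as half the ordered sum). -/
def isingWeight (β h : ℝ) (Λ : Finset (ℤ × ℤ)) (σ ω : Cfg2) : ℝ :=
  Real.exp (β * ((∑ x ∈ Λ, ∑ y ∈ Λ.filter (fun y => y ∈ nbrs x),
        sval (ω x) * sval (ω y)) / 2
      + ∑ x ∈ Λ, ∑ y ∈ (nbrs x).filter (fun y => y ∉ Λ), sval (ω x) * sval (σ y))
    - h * ∑ x ∈ Λ, sval (ω x))

/-- Fill in the values `τ` inside `Λ` and `σ` outside. -/
def fill (Λ : Finset (ℤ × ℤ)) (σ : Cfg2) (τ : ↥Λ → Bool) : Cfg2 :=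
  fun x => if hx : x ∈ Λ then τ ⟨x, hx⟩ else σ x

/-- The finite-volume Ising measure in `Λ` with boundary condition `σ`, viewed as a measure on
the full configuration space, the spins outside `Λ` being frozen to `σ`. -/
def isingFV (β h : ℝ) (Λ : Finset (ℤ × ℤ)) (σ : Cfg2) : Measure Cfg2 :=
  (∑ τ : ↥Λ → Bool, ENNReal.ofReal (isingWeight β h Λ σ (fill Λ σ τ)))⁻¹ •
    ∑ τ : ↥Λ → Bool,
      ENNReal.ofReal (isingWeight β h Λ σ (fill Λ σ τ)) • Measure.dirac (fill Λ σ τ)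

/-- The box `[-n,n]²`. -/
def box (n : ℕ) : Finset (ℤ × ℤ) :=
  (Finset.Icc (-(n : ℤ)) (n : ℤ)) ×ˢ (Finset.Icc (-(n : ℤ)) (n : ℤ))

/-- Convergence of a sequence of measures on a product space in the sense of convergence of the
measures of all finite-dimensional cylinder events; for probability measures on `{−1,+1}^ι`
this is exactly weak convergence. -/
def CylTendsto {ι A : Type*} [MeasurableSpace A] (μs : ℕ → Measure (ι → A))
    (μ : Measure (ι → A)) : Prop :=
  ∀ (s : Finset ι) (f : ι → A),
    Tendsto (fun n => μs n {η | ∀ i ∈ s, η i = f i}) atTop (𝓝 (μ {η | ∀ i ∈ s, η i = f i}))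

/-- `μ` is the plus phase `μ_{β,h}^+`: the weak limit of the finite-volume Ising measures on
`[-n,n]²` with all-plus boundary conditions. -/
def IsPlusPhase (β h : ℝ) (μ : Measure Cfg2) : Prop :=
  IsProbabilityMeasure μ ∧ CylTendsto (fun n => isingFV β h (box n) (fun _ => true)) μ

/-- `μ` is the minus phase `μ_{β,h}^-`. -/
def IsMinusPhase (β h : ℝ) (μ : Measure Cfg2) : Prop :=
  IsProbabilityMeasure μ ∧ CylTendsto (fun n => isingFV β h (box n) (fun _ => false)) μ

/-- The critical inverse temperature `β_c = ln(1+√2)/2`. -/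
def betaCrit : ℝ := Real.log (1 + Real.sqrt 2) / 2

/-- Projection of a two-dimensional configuration onto the line `ℤ × {0}`. -/
def lineProj (η : Cfg2) : ZSeq Bool := fun i => η (i, 0)

/-- The Schonmann projection of a measure on `{−1,+1}^{ℤ²}`. -/
def schonmann (μ : Measure Cfg2) : Measure (ZSeq Bool) := μ.map lineProj

/-- Restriction of a two-sided sequence to its strict past; index `k` is coordinate `-(k+1)`. -/
def restrictPast {A : Type*} (ω : ZSeq A) : Past A := fun k => ω (-(k + 1 : ℤ))

/-- The shift on two-sided sequences. -/
def shiftSeq {A : Type*} : ZSeq A → ZSeq A := fun ω i => ω (i + 1)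

/-- The σ-algebra `ℱ_{<0}` generated by the coordinates of negative index. -/
def pastSigma (A : Type*) [MeasurableSpace A] : MeasurableSpace (ZSeq A) :=
  MeasurableSpace.comap (fun ω : ZSeq A => restrictPast ω) inferInstance

/-- The σ-algebra generated by the coordinates in `S`. -/
def sigmaOn {ι A : Type*} [MeasurableSpace A] (S : Set ι) : MeasurableSpace (ι → A) :=
  MeasurableSpace.comap (fun ω : ι → A => S.restrict ω) inferInstance

/-- A g-function on the alphabet `A`: measurable, `[0,1]`-valued, normalized. -/
def IsGFunction {A : Type*} [Fintype A] [MeasurableSpace A] (P : A → Past A → ℝ) : Prop :=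
  (∀ a, Measurable (P a)) ∧ ∀ ω, (∑ a : A, P a ω) = 1 ∧ ∀ a, P a ω ∈ Set.Icc (0 : ℝ) 1

/-- `μ` is a translation-invariant g-measure consistent with the g-function `P`: for each `a`,
`ω ↦ P a (restrictPast ω)` is a version of the conditional probability `μ(X₀ = a | ℱ_{<0})`. -/
def IsGMeasure {A : Type*} [MeasurableSpace A] (μ : Measure (ZSeq A))
    (P : A → Past A → ℝ) : Prop :=
  IsProbabilityMeasure μ ∧ μ.map shiftSeq = μ ∧
    ∀ a : A, (fun ω => P a (restrictPast ω))
      =ᵐ[μ] μ[Set.indicator {ω : ZSeq A | ω 0 = a} (fun _ => (1 : ℝ)) | pastSigma A]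

/-- The `k`-th variation of a g-function: the supremum of `|P a ω − P a σ|` over pasts agreeing
on the coordinates `−k,…,−1`. -/
def varG {A : Type*} (P : A → Past A → ℝ) (k : ℕ) : ℝ :=
  sSup {d : ℝ | ∃ (a : A) (ω σ' : Past A), (∀ j < k, ω j = σ' j) ∧ d = |P a ω - P a σ'|}

/-- Elementary conditional probability `μ(B | A)`, as a real number. -/
def condProbR {X : Type*} [MeasurableSpace X] (μ : Measure X) (B A : Set X) : ℝ :=
  ((μ[|A]) B).toReal

/-- The event that `η_i = ω` (suitably reindexed) for `−n ≤ i ≤ −1` and `η_i = b`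
for `−(n+l) ≤ i ≤ −(n+1)`. -/
def pastEvt (n l : ℕ) (b : Bool) (ω : Past Bool) : Set (ZSeq Bool) :=
  {η | (∀ i : ℤ, -(n : ℤ) ≤ i → i ≤ -1 → η i = ω (i.natAbs - 1)) ∧
       (∀ i : ℤ, -((n : ℤ) + l) ≤ i → i ≤ -((n : ℤ) + 1) → η i = b)}

/-- The event that `η_i = b` for `−(n+l) ≤ i ≤ −n`. -/
def blockEvt (n l : ℕ) (b : Bool) : Set (ZSeq Bool) :=
  {η | ∀ i : ℤ, -((n : ℤ) + l) ≤ i → i ≤ -(n : ℤ) → η i = b}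

/-- The event that `η_i = b` for `−n ≤ i ≤ −1`. -/
def allBlock (n : ℕ) (b : Bool) : Set (ZSeq Bool) :=
  {η | ∀ i : ℤ, -(n : ℤ) ≤ i → i ≤ -1 → η i = b}

/-- `P` is the g-function `P^{+,b}` obtained from `ν` by conditioning on the symbol `b`
in the far past: `P(a|ω) = lim_n lim_l ν(η₀ = a | η = b on [−(n+l),−(n+1)], η = ω on [−n,−1])`,
both iterated limits being required to exist. -/
def IsCondG (ν : Measure (ZSeq Bool)) (b : Bool) (P : Bool → Past Bool → ℝ) : Prop :=
  ∀ (a : Bool) (ω : Past Bool), ∃ L : ℕ → ℝ,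
    (∀ n, Tendsto (fun l => condProbR ν {η | η 0 = a} (pastEvt n l b ω)) atTop (𝓝 (L n))) ∧
    Tendsto L atTop (𝓝 (P a ω))

/-- `ν'` is the iterated weak limit `lim_n lim_l ν( · | η = b on [−(n+l),−n])`. -/
def IsCondLimitMeasure (ν : Measure (ZSeq Bool)) (b : Bool) (ν' : Measure (ZSeq Bool)) : Prop :=
  ∃ νseq : ℕ → Measure (ZSeq Bool),
    (∀ n, CylTendsto (fun l => ν[|blockEvt n l b]) (νseq n)) ∧ CylTendsto νseq ν'

/-- Stochastic domination: `ν ≤ μ` iff `ν B ≤ μ B` for every increasing measurable event `B`. -/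
def StochDom {A : Type*} [MeasurableSpace A] [Preorder A]
    (ν μ : Measure (ZSeq A)) : Prop :=
  ∀ B : Set (ZSeq A), MeasurableSet B → (∀ ⦃x y : ZSeq A⦄, x ≤ y → x ∈ B → y ∈ B) → ν B ≤ μ B

/-- `π` is the i.i.d. product measure with `π(η_i = +1) = ρ` for each coordinate. -/
def IsBernoulliProd (ρ : ℝ) (π : Measure (ZSeq Bool)) : Prop :=
  IsProbabilityMeasure π ∧ ∀ (s : Finset ℤ) (f : ℤ → Bool),
    π {η | ∀ i ∈ s, η i = f i} = ∏ i ∈ s, ENNReal.ofReal (if f i then ρ else 1 - ρ)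

/-- Splicing of pasts: coordinates `−k,…,−1` (indices `< k`) from `ω`, the rest from `σ`. -/
def splice {A : Type*} (σ ω : Past A) (k : ℕ) : Past A := fun j => if j < k then ω j else σ j

/-- `ν'` is an extreme point of the convex set of g-measures consistent with `P`. -/
def ExtremeGMeasure (ν' : Measure (ZSeq Bool)) (P : Bool → Past Bool → ℝ) : Prop :=
  IsGMeasure ν' P ∧
  ∀ ν₁ ν₂ : Measure (ZSeq Bool), IsGMeasure ν₁ P → IsGMeasure ν₂ P →
    ∀ t : ℝ, t ∈ Set.Ioo (0 : ℝ) 1 →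
      ν' = ENNReal.ofReal t • ν₁ + ENNReal.ofReal (1 - t) • ν₂ → ν₁ = ν' ∧ ν₂ = ν'

/-- The event that the spins on the line are `−1` on `{−m,…,−n} × {0}`. -/
def lineMinusEvt (n m : ℕ) : Set Cfg2 :=
  {η | ∀ i : ℤ, -(m : ℤ) ≤ i → i ≤ -(n : ℤ) → η (i, 0) = false}

/-- Nearest-neighbour adjacency in `ℤ²` (`‖x−y‖₁ = 1`). -/
def adj2 (x y : ℤ × ℤ) : Prop := (x.1 - y.1).natAbs + (x.2 - y.2).natAbs = 1

/-- The event `A_n`: there is an infinite nearest-neighbour path of `+1` spins starting at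
`(n,0)` entirely contained in the half-plane `{x ≤ n}`. -/
def plusPathEvt (n : ℕ) : Set Cfg2 :=
  {η | ∃ γ : ℕ → ℤ × ℤ, γ 0 = ((n : ℤ), 0) ∧ (∀ j, adj2 (γ j) (γ (j + 1))) ∧
    Function.Injective γ ∧ (∀ j, (γ j).1 ≤ (n : ℤ)) ∧ ∀ j, η (γ j) = true}

/-- The block map for the decimation `ν_{l,k}`: the `j`-th letter consists of the spins on
`[j(k+l), j(k+l)+l−1]`. -/
def blockMap (l k : ℕ) (η : ZSeq Bool) : ZSeq (Fin l → Bool) :=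
  fun j r => η (j * ((k : ℤ) + l) + r)

end

section IsingLattice

lemma mem_nbrs_comm {x y : ℤ × ℤ} : y ∈ nbrs x ↔ x ∈ nbrs y := by
  simp only [nbrs, Finset.mem_insert, Finset.mem_singleton, Prod.ext_iff]
  omega

lemma mem_box {n : ℕ} {x : ℤ × ℤ} :
    x ∈ box n ↔ (-(n : ℤ) ≤ x.1 ∧ x.1 ≤ n) ∧ (-(n : ℤ) ≤ x.2 ∧ x.2 ≤ n) := by
  simp [box, Finset.mem_product]

lemma box_mono {n N : ℕ} (h : n ≤ N) : box n ⊆ box N := by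
  intro x hx
  rw [mem_box] at hx ⊢
  omega

lemma nbrs_subset_box {n M : ℕ} (h : n < M) {x : ℤ × ℤ} (hx : x ∈ box n) : nbrs x ⊆ box M := by
  intro y hy
  simp only [nbrs, Finset.mem_insert, Finset.mem_singleton, Prod.ext_iff] at hy
  rw [mem_box] at hx ⊢
  omega

/-- The configurations that are plus outside `box n`. -/
def plusOff (n : ℕ) : Set Cfg2 := {ω | ∀ x ∉ box n, ω x = true}

/-- Twice the nearest-neighbour interaction inside `M`. -/
noncomputable def pairSum (M : Finset (ℤ × ℤ)) (ω : Cfg2) : ℝ :=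
  ∑ x ∈ M, ∑ y ∈ M with y ∈ nbrs x, sval (ω x) * sval (ω y)

/-- The free Gibbs weight of the restriction of a configuration to `box M`. -/
noncomputable def gibbsWeight (β : ℝ) (M : ℕ) (ω : Cfg2) : ℝ :=
  Real.exp (β * (pairSum (box M) ω / 2))

lemma gibbsWeight_pos (β : ℝ) (M : ℕ) (ω : Cfg2) : 0 < gibbsWeight β M ω := Real.exp_pos _

lemma sval_mul_add_le (a b c d : Bool) :
    sval a * sval c + sval b * sval d ≤
      sval (a ⊓ b) * sval (c ⊓ d) + sval (a ⊔ b) * sval (c ⊔ d) := by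
  cases a <;> cases b <;> cases c <;> cases d <;> norm_num [sval]

lemma gibbsWeight_mul_le {β : ℝ} (hβ : 0 ≤ β) (M : ℕ) (a b : Cfg2) :
    gibbsWeight β M a * gibbsWeight β M b ≤ gibbsWeight β M (a ⊓ b) * gibbsWeight β M (a ⊔ b) := by
  have h : pairSum (box M) a + pairSum (box M) b ≤
      pairSum (box M) (a ⊓ b) + pairSum (box M) (a ⊔ b) := by
    simp only [pairSum, ← Finset.sum_add_distrib]
    exact Finset.sum_le_sum fun x _ => Finset.sum_le_sum fun y _ => sval_mul_add_le _ _ _ _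
  simp only [gibbsWeight, ← Real.exp_add]
  apply Real.exp_le_exp.2
  nlinarith

/-- Changing a configuration inside `Λ` only changes the pair interactions meeting `Λ`. -/
lemma pairSum_sub_one {Λ M : Finset (ℤ × ℤ)} (hΛM : Λ ⊆ M) (hM : ∀ x ∈ Λ, nbrs x ⊆ M) {ω : Cfg2}
    (hω : ∀ x ∉ Λ, ω x = true) :
    ∑ x ∈ M, ∑ y ∈ M with y ∈ nbrs x, (sval (ω x) * sval (ω y) - 1) =
      ∑ x ∈ Λ, ∑ y ∈ Λ with y ∈ nbrs x, (sval (ω x) * sval (ω y) - 1) +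
      2 * ∑ x ∈ Λ, ∑ y ∈ nbrs x with y ∉ Λ, (sval (ω x) * sval (ω y) - 1) := by
  have hbd : ∀ x ∈ Λ, (nbrs x).filter (fun y => y ∉ Λ) = (M \ Λ).filter (fun y => y ∈ nbrs x) := by
    intro x hx
    ext y
    have := @hM x hx y
    simp only [Finset.mem_filter, Finset.mem_sdiff]
    tauto
  rw [Finset.sum_congr (s₁ := Λ) rfl fun x hx => Finset.sum_congr (hbd x hx) fun _ _ => rfl]
  simp only [Finset.sum_filter]
  set a : ℤ × ℤ → ℤ × ℤ → ℝ := fun x y =>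
    if y ∈ nbrs x then sval (ω x) * sval (ω y) - 1 else 0 with ha
  have hsymm : ∀ x y, a x y = a y x := by
    intro x y
    simp only [ha, mem_nbrs_comm (x := x), mul_comm (sval (ω x))]
  have hzero : ∀ x ∈ M \ Λ, ∀ y ∈ M \ Λ, a x y = 0 := by
    intro x hx y hy
    simp [ha, hω x (Finset.mem_sdiff.1 hx).2, hω y (Finset.mem_sdiff.1 hy).2, sval]
  have hcross : ∑ x ∈ M \ Λ, ∑ y ∈ Λ, a x y = ∑ x ∈ Λ, ∑ y ∈ M \ Λ, a x y := by
    rw [Finset.sum_comm]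
    exact Finset.sum_congr rfl fun x _ => Finset.sum_congr rfl fun y _ => hsymm _ _
  have hsplit : ∀ f : ℤ × ℤ → ℝ, ∑ x ∈ M, f x = ∑ x ∈ M \ Λ, f x + ∑ x ∈ Λ, f x := fun f =>
    (Finset.sum_sdiff hΛM).symm
  change ∑ x ∈ M, ∑ y ∈ M, a x y = ∑ x ∈ Λ, ∑ y ∈ Λ, a x y + 2 * ∑ x ∈ Λ, ∑ y ∈ M \ Λ, a x y
  simp only [hsplit, Finset.sum_add_distrib]
  rw [hcross, Finset.sum_eq_zero fun x hx => Finset.sum_eq_zero (hzero x hx)]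
  ring

lemma isingWeight_eq (β : ℝ) {n M : ℕ} (h : n < M) :
    ∃ K : ℝ, 0 < K ∧ ∀ ω ∈ plusOff n,
      isingWeight β 0 (box n) (fun _ => true) ω = K * gibbsWeight β M ω := by
  refine ⟨isingWeight β 0 (box n) (fun _ => true) (fun _ => true) /
    gibbsWeight β M (fun _ => true), div_pos (Real.exp_pos _) (gibbsWeight_pos _ _ _), ?_⟩
  intro ω hω
  have key := pairSum_sub_one (box_mono h.le) (fun x hx => nbrs_subset_box h hx) hω
  have hb : ∀ x ∈ box n, ∑ y ∈ nbrs x with y ∉ box n, sval (ω x) * sval (ω y) =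
      ∑ y ∈ nbrs x with y ∉ box n, sval (ω x) * sval true := by
    intro x _
    refine Finset.sum_congr rfl fun y hy => ?_
    rw [hω y (Finset.mem_filter.1 hy).2]
  simp only [Finset.sum_sub_distrib] at key
  rw [Finset.sum_congr rfl hb] at key
  rw [div_mul_eq_mul_div, eq_div_iff (gibbsWeight_pos _ _ _).ne']
  simp only [isingWeight, gibbsWeight, pairSum, ← Real.exp_add]
  congr 1
  simp only [sval, if_true, mul_one, zero_mul, sub_zero] at key ⊢
  linear_combination -β / 2 * key

open Classical in
/-- The finitely many configurations that are plus outside `box n`. -/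
noncomputable def plusConfigs (n : ℕ) : Finset Cfg2 :=
  Finset.univ.image (fill (box n) (fun _ => true))

lemma mem_plusConfigs {n : ℕ} {ω : Cfg2} : ω ∈ plusConfigs n ↔ ω ∈ plusOff n := by
  simp only [plusConfigs, Finset.mem_image, Finset.mem_univ, true_and]
  constructor
  · rintro ⟨τ, rfl⟩ x hx
    simp [fill, hx]
  · intro hω
    refine ⟨fun x => ω x, funext fun x => ?_⟩
    by_cases hx : x ∈ box n
    · simp [fill, hx]
    · simp [fill, hx, hω x hx]

lemma fill_injective (Λ : Finset (ℤ × ℤ)) (σ : Cfg2) : Function.Injective (fill Λ σ) := by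
  intro τ τ' h
  ext x
  have := congrFun h x
  simp only [fill, x.2, dif_pos] at this
  exact this

/-- The unnormalised mass of an event among the configurations that are plus outside `box n`. -/
noncomputable def plusMass (β : ℝ) (M n : ℕ) (A : Set Cfg2) : ℝ :=
  ∑ ω ∈ plusConfigs n, A.indicator (gibbsWeight β M) ω

lemma indicator_gibbsWeight_nonneg (β : ℝ) (M : ℕ) (A : Set Cfg2) :
    0 ≤ A.indicator (gibbsWeight β M) :=
  fun _ => Set.indicator_nonneg (fun _ _ => (gibbsWeight_pos _ _ _).le) _

lemma plusMass_nonneg (β : ℝ) (M n : ℕ) (A : Set Cfg2) : 0 ≤ plusMass β M n A :=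
  Finset.sum_nonneg fun ω _ => indicator_gibbsWeight_nonneg β M A ω

lemma plusMass_pos (β : ℝ) (M : ℕ) {n : ℕ} {A : Set Cfg2} {ω : Cfg2} (hω : ω ∈ plusOff n)
    (hA : ω ∈ A) : 0 < plusMass β M n A := by
  refine Finset.sum_pos' (fun ω _ => indicator_gibbsWeight_nonneg β M A ω)
    ⟨ω, mem_plusConfigs.2 hω, ?_⟩
  rw [Set.indicator_of_mem hA]
  exact gibbsWeight_pos _ _ _

lemma plusMass_univ_pos (β : ℝ) (M n : ℕ) : 0 < plusMass β M n Set.univ :=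
  plusMass_pos β M (ω := fun _ => true) (fun _ _ => rfl) trivial

lemma plusMass_plusOff_inter (β : ℝ) (M : ℕ) {n N : ℕ} (h : n ≤ N) (A : Set Cfg2) :
    plusMass β M N (plusOff n ∩ A) = plusMass β M n A := by
  have hsub : plusConfigs n ⊆ plusConfigs N := fun ω hω =>
    mem_plusConfigs.2 fun x hx => mem_plusConfigs.1 hω x fun hx' => hx (box_mono h hx')
  unfold plusMass
  rw [← Finset.sum_subset hsub fun ω _ hω =>
    Set.indicator_of_notMem
    (fun hA : ω ∈ plusOff n ∩ A => hω (mem_plusConfigs.2 hA.1)) _]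
  refine Finset.sum_congr rfl fun ω hω => ?_
  by_cases hA : ω ∈ A
  · rw [Set.indicator_of_mem hA,
      Set.indicator_of_mem (Set.mem_inter (mem_plusConfigs.1 hω) hA)]
  · rw [Set.indicator_of_notMem hA,
      Set.indicator_of_notMem fun h => hA (Set.mem_of_mem_inter_right h)]

open FinsetFamily in
lemma plusMass_mul_le {β : ℝ} (hβ : 0 ≤ β) (M N : ℕ) {A₁ A₂ A₃ A₄ : Set Cfg2}
    (hinf : ∀ a ∈ A₁, ∀ b ∈ A₂, a ⊓ b ∈ A₃) (hsup : ∀ a ∈ A₁, ∀ b ∈ A₂, a ⊔ b ∈ A₄) :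
    plusMass β M N A₁ * plusMass β M N A₂ ≤ plusMass β M N A₃ * plusMass β M N A₄ := by
  classical
  have hle := four_functions_theorem _ _ _ _ (indicator_gibbsWeight_nonneg β M A₁)
    (indicator_gibbsWeight_nonneg β M A₂) (indicator_gibbsWeight_nonneg β M A₃)
    (indicator_gibbsWeight_nonneg β M A₄) (fun a b => by
      by_cases ha : a ∈ A₁
      · by_cases hb : b ∈ A₂
        · rw [Set.indicator_of_mem ha, Set.indicator_of_mem hb,
            Set.indicator_of_mem (hinf a ha b hb), Set.indicator_of_mem (hsup a ha b hb)]
          exact gibbsWeight_mul_le hβ M a b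
        · rw [Set.indicator_of_notMem hb, mul_zero]
          exact mul_nonneg (indicator_gibbsWeight_nonneg _ _ _ _)
            (indicator_gibbsWeight_nonneg _ _ _ _)
      · rw [Set.indicator_of_notMem ha, zero_mul]
        exact mul_nonneg (indicator_gibbsWeight_nonneg _ _ _ _)
          (indicator_gibbsWeight_nonneg _ _ _ _)) (plusConfigs N) (plusConfigs N)
  have hinfs : plusConfigs N ⊼ plusConfigs N ⊆ plusConfigs N := by
    rw [Finset.infs_subset_iff]
    intro a ha b hb
    rw [mem_plusConfigs] at ha hb ⊢
    intro x hx
    simp [ha x hx, hb x hx]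
  have hsups : plusConfigs N ⊻ plusConfigs N ⊆ plusConfigs N := by
    rw [Finset.sups_subset_iff]
    intro a ha b hb
    rw [mem_plusConfigs] at ha hb ⊢
    intro x hx
    simp [ha x hx]
  refine hle.trans (mul_le_mul ?_ ?_ ?_ (plusMass_nonneg _ _ _ _))
  · exact Finset.sum_le_sum_of_subset_of_nonneg hinfs
      fun _ _ _ => indicator_gibbsWeight_nonneg _ _ _ _
  · exact Finset.sum_le_sum_of_subset_of_nonneg hsups
      fun _ _ _ => indicator_gibbsWeight_nonneg _ _ _ _
  · exact Finset.sum_nonneg fun _ _ => indicator_gibbsWeight_nonneg _ _ _ _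

lemma isingFV_apply (β : ℝ) {n M : ℕ} (h : n < M) {A : Set Cfg2} (hA : MeasurableSet A) :
    isingFV β 0 (box n) (fun _ => true) A =
      (ENNReal.ofReal (plusMass β M n Set.univ))⁻¹ * ENNReal.ofReal (plusMass β M n A) := by
  classical
  obtain ⟨K, hK, hw⟩ := isingWeight_eq β h
  have hfill : ∀ τ, fill (box n) (fun _ => true) τ ∈ plusOff n := fun τ =>
    mem_plusConfigs.1 (Finset.mem_image_of_mem _ (Finset.mem_univ _))
  have hmass : ∀ A : Set Cfg2, ∑ τ : ↥(box n) → Bool,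
      ENNReal.ofReal (isingWeight β 0 (box n) (fun _ => true) (fill (box n) (fun _ => true) τ)) *
        A.indicator 1 (fill (box n) (fun _ => true) τ) =
      ENNReal.ofReal K * ENNReal.ofReal (plusMass β M n A) := by
    intro A
    rw [plusMass, plusConfigs, Finset.sum_image ((fill_injective _ _).injOn),
      ENNReal.ofReal_sum_of_nonneg fun _ _ => indicator_gibbsWeight_nonneg _ _ _ _, Finset.mul_sum]
    refine Finset.sum_congr rfl fun τ _ => ?_
    rw [hw _ (hfill τ), ENNReal.ofReal_mul hK.le]
    by_cases hτ : fill (box n) (fun _ => true) τ ∈ A <;> simp [hτ]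
  have huniv := hmass Set.univ
  simp only [Set.indicator_univ, Pi.one_apply, mul_one] at huniv
  have hK0 : ENNReal.ofReal K ≠ 0 := by simpa using hK
  rw [isingFV, huniv, Measure.smul_apply, Measure.finsetSum_apply]
  simp only [Measure.smul_apply, smul_eq_mul, Measure.dirac_apply' _ hA]
  rw [hmass, ENNReal.mul_inv (Or.inl hK0) (Or.inl ENNReal.ofReal_ne_top), mul_mul_mul_comm,
    ENNReal.inv_mul_cancel hK0 ENNReal.ofReal_ne_top, one_mul]

/-- Comparison of two plus-boundary Ising measures, in the form of the Ahlswede-Daykin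
inequality combined with the domain Markov property. -/
lemma isingFV_mul_le {β : ℝ} (hβ : 0 ≤ β) {n N : ℕ} (hnN : n ≤ N) {A₁ A₂ A₃ A₄ : Set Cfg2}
    (h₁ : MeasurableSet A₁) (h₂ : MeasurableSet A₂) (h₃ : MeasurableSet A₃)
    (h₄ : MeasurableSet A₄) (hinf : ∀ a ∈ A₁, ∀ b ∈ plusOff n, b ∈ A₂ → a ⊓ b ∈ A₃)
    (hsup : ∀ a ∈ A₁, ∀ b ∈ plusOff n, b ∈ A₂ → a ⊔ b ∈ A₄) :
    isingFV β 0 (box N) (fun _ => true) A₁ * isingFV β 0 (box n) (fun _ => true) A₂ ≤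
      isingFV β 0 (box N) (fun _ => true) A₃ * isingFV β 0 (box n) (fun _ => true) A₄ := by
  have hle := plusMass_mul_le hβ (N + 1) N (A₁ := A₁) (A₂ := plusOff n ∩ A₂) (A₃ := A₃)
    (A₄ := plusOff n ∩ A₄) (fun a ha b hb => hinf a ha b hb.1 hb.2)
    (fun a ha b hb => ⟨fun x hx => by simp [hb.1 x hx], hsup a ha b hb.1 hb.2⟩)
  rw [plusMass_plusOff_inter _ _ hnN, plusMass_plusOff_inter _ _ hnN] at hle
  have hN : N < N + 1 := N.lt_succ_self
  have hn : n < N + 1 := Nat.lt_succ_of_le hnN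
  rw [isingFV_apply β hN h₁, isingFV_apply β hn h₂, isingFV_apply β hN h₃, isingFV_apply β hn h₄,
    mul_mul_mul_comm, mul_mul_mul_comm _ (ENNReal.ofReal (plusMass β (N + 1) N A₃)),
    ← ENNReal.ofReal_mul (plusMass_nonneg _ _ _ _), ← ENNReal.ofReal_mul (plusMass_nonneg _ _ _ _)]
  gcongr

lemma isingFV_ne_top (β : ℝ) (n : ℕ) {A : Set Cfg2} (hA : MeasurableSet A) :
    isingFV β 0 (box n) (fun _ => true) A ≠ ⊤ := by
  rw [isingFV_apply β n.lt_succ_self hA]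
  refine ENNReal.mul_ne_top (ENNReal.inv_ne_top.2 ?_) ENNReal.ofReal_ne_top
  simpa using plusMass_univ_pos β (n + 1) n

lemma isingFV_ne_zero (β : ℝ) {n : ℕ} {A : Set Cfg2} (hA : MeasurableSet A) {ω : Cfg2}
    (hω : ω ∈ plusOff n) (hωA : ω ∈ A) : isingFV β 0 (box n) (fun _ => true) A ≠ 0 := by
  rw [isingFV_apply β n.lt_succ_self hA]
  refine mul_ne_zero (ENNReal.inv_ne_zero.2 ENNReal.ofReal_ne_top) ?_
  simpa using plusMass_pos β (n + 1) hω hωA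

end IsingLattice

section Cylinders

open MeasurableSet (of_mem_measurableCylinders)
open scoped symmDiff

/-- An inequality between finite measures extends from a generating algebra of sets. -/
lemma measure_le_of_isSetAlgebra {α : Type*} [mα : MeasurableSpace α] {ν₁ ν₂ : Measure α}
    [IsFiniteMeasure ν₁] [IsFiniteMeasure ν₂] {𝒞 : Set (Set α)} (h𝒞 : IsSetAlgebra 𝒞)
    (hgen : mα = MeasurableSpace.generateFrom 𝒞) (hle : ∀ C ∈ 𝒞, ν₁ C ≤ ν₂ C) {B : Set α}
    (hB : MeasurableSet B) : ν₁ B ≤ ν₂ B := by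
  refine ENNReal.le_of_forall_pos_le_add fun ε hε _ => ?_
  obtain ⟨C, hC, hCB⟩ := exists_measure_symmDiff_lt_of_generateFrom_isSetRing (μ := ν₁ + ν₂)
    h𝒞.isSetRing ⟨{Set.univ}, Set.countable_singleton _, by simpa using h𝒞.univ_mem, by simp⟩
    hgen hB
    (ENNReal.coe_pos.2 hε)
  have h₁ : ν₁ B ≤ ν₁ C + ν₁ (C ∆ B) := by
    refine (measure_mono fun x hx => ?_).trans (measure_union_le C (C ∆ B))
    by_cases hxC : x ∈ C
    · exact Or.inl hxC
    · exact Or.inr (Or.inr ⟨hx, hxC⟩)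
  have h₂ : ν₂ C ≤ ν₂ B + ν₂ (C ∆ B) := by
    refine (measure_mono fun x hx => ?_).trans (measure_union_le B (C ∆ B))
    by_cases hxB : x ∈ B
    · exact Or.inl hxB
    · exact Or.inr (Or.inl ⟨hx, hxB⟩)
  calc ν₁ B ≤ ν₁ C + ν₁ (C ∆ B) := h₁
    _ ≤ ν₂ B + ν₂ (C ∆ B) + ν₁ (C ∆ B) := by
      gcongr
      exact (hle C hC).trans h₂
    _ = ν₂ B + (ν₁ + ν₂) (C ∆ B) := by rw [Measure.add_apply]; ring
    _ ≤ ν₂ B + ε := by gcongr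

lemma CylTendsto.tendsto_of_mem {μs : ℕ → Measure Cfg2} {μ : Measure Cfg2} (h : CylTendsto μs μ)
    {A : Set Cfg2} (hA : A ∈ measurableCylinders (fun _ : ℤ × ℤ => Bool)) :
    Tendsto (fun n => μs n A) atTop (𝓝 (μ A)) := by
  classical
  obtain ⟨s, S, -, rfl⟩ := (mem_measurableCylinders _).1 hA
  have hsum : ∀ ν : Measure Cfg2, ν (cylinder s S) =
      ∑ g : ↥s → Bool with g ∈ S, ν {η | ∀ i ∈ s, η i = fill s (fun _ => true) g i} := by
    intro ν
    have hcyl : ∀ g : ↥s → Bool,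
        {η : Cfg2 | ∀ i ∈ s, η i = fill s (fun _ => true) g i} =
        (s.restrict : Cfg2 → ↥s → Bool) ⁻¹' {g} := by
      intro g
      ext η
      simp only [Set.mem_ofPred_eq, Set.mem_preimage, Set.mem_singleton_iff, funext_iff,
        Subtype.forall, Finset.restrict, fill]
      exact forall₂_congr fun i hi => by rw [dif_pos hi]
    simp only [hcyl]
    have hsum := sum_measure_preimage_singleton (μ := ν) (f := (s.restrict : Cfg2 → ↥s → Bool))
      (Finset.univ.filter (· ∈ S)) fun g _ =>
        (Finset.measurable_restrict s) (measurableSet_singleton g)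
    simp only [Finset.coe_filter, Finset.mem_univ, true_and, Set.ofPred_mem_eq] at hsum
    exact hsum.symm
  simp only [hsum]
  exact tendsto_finsetSum _ fun g _ => h s _

lemma preimage_restrict_mem_measurableCylinders {U : Set (ℤ × ℤ)} {C : Set (U → Bool)}
    (hC : C ∈ measurableCylinders (fun _ : U => Bool)) :
    (fun η : Cfg2 => fun x : U => η x) ⁻¹' C ∈ measurableCylinders (fun _ : ℤ × ℤ => Bool) := by
  obtain ⟨t, S, -, rfl⟩ := (mem_measurableCylinders _).1 hC
  refine (mem_measurableCylinders _).2 ⟨t.map (Function.Embedding.subtype _),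
    {g | (fun i : t => g ⟨i.1, Finset.mem_map_of_mem _ i.2⟩) ∈ S}, (Set.toFinite _).measurableSet,
    rfl⟩

/-- The event that all spins in `s` are plus. -/
def plusOn (s : Finset (ℤ × ℤ)) : Set Cfg2 := {η | ∀ x ∈ s, η x = true}

lemma plusOn_mem_measurableCylinders (s : Finset (ℤ × ℤ)) :
    plusOn s ∈ measurableCylinders (fun _ : ℤ × ℤ => Bool) := by
  refine (mem_measurableCylinders _).2 ⟨s, {fun _ => true}, measurableSet_singleton _, ?_⟩
  ext η
  simp [plusOn, cylinder, funext_iff]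

lemma lineMinusEvt_mem_measurableCylinders (n m : ℕ) :
    lineMinusEvt n m ∈ measurableCylinders (fun _ : ℤ × ℤ => Bool) := by
  classical
  refine (mem_measurableCylinders _).2 ⟨(Finset.Icc (-(m : ℤ)) (-(n : ℤ))).image (fun i => (i, 0)),
    {fun _ => false}, measurableSet_singleton _, ?_⟩
  ext η
  simp only [lineMinusEvt, cylinder, Set.mem_ofPred_eq, Set.mem_preimage, Set.mem_singleton_iff,
    funext_iff, Subtype.forall, Finset.forall_mem_image, Finset.mem_Icc, Finset.restrict, and_imp]

/-- A finite measure is determined by the probabilities of being plus on finite sets. -/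
lemma measure_ext_of_plusOn {ν₁ ν₂ : Measure Cfg2} [IsFiniteMeasure ν₁]
    (h : ∀ s, ν₁ (plusOn s) = ν₂ (plusOn s)) : ν₁ = ν₂ := by
  classical
  refine ext_of_generate_finite (Set.range plusOn) (le_antisymm ?_ ?_) ?_ ?_ ?_
  · refine iSup_le fun x => ?_
    rw [MeasurableSpace.comap_le_iff_le_map]
    change Measurable[MeasurableSpace.generateFrom (Set.range plusOn)] fun η : Cfg2 => η x
    refine measurable_to_bool (MeasurableSpace.measurableSet_generateFrom ⟨{x}, ?_⟩)
    ext η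
    simp [plusOn]
  · refine MeasurableSpace.generateFrom_le ?_
    rintro _ ⟨s, rfl⟩
    exact of_mem_measurableCylinders (plusOn_mem_measurableCylinders s)
  · rintro _ ⟨s, rfl⟩ _ ⟨t, rfl⟩ -
    refine ⟨s ∪ t, ?_⟩
    ext η
    simp [plusOn, or_imp, forall_and]
  · rintro _ ⟨s, rfl⟩
    exact h s
  · simpa [plusOn] using h ∅

end Cylinders

section ConditionedMeasure

open MeasurableSet (of_mem_measurableCylinders)

lemma lineMinusEvt_anti {n m m' : ℕ} (h : m ≤ m') : lineMinusEvt n m' ⊆ lineMinusEvt n m :=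
  fun _ hη i hi hi' => hη i (by omega) hi'

lemma isingFV_lineMinusEvt_ne_zero (β : ℝ) (n : ℕ) :
    isingFV β 0 (box n) (fun _ => true) (lineMinusEvt 1 n) ≠ 0 := by
  classical
  refine isingFV_ne_zero β (of_mem_measurableCylinders (lineMinusEvt_mem_measurableCylinders 1 n))
    (ω := fun x => decide (x ∉ box n)) (fun x hx => by simpa using hx) fun i hi hi' => ?_
  have : (i, (0 : ℤ)) ∈ box n := by
    rw [mem_box]
    push_cast at hi'
    omega
  simpa using this

variable {β : ℝ} {μp μh : Measure Cfg2}

lemma plusPhase_mul_le (hβ : 0 ≤ β) (hμp : IsPlusPhase β 0 μp) (s : Finset (ℤ × ℤ)) {n m : ℕ}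
    (hnm : n ≤ m) {C : Set Cfg2} (hC : C ∈ measurableCylinders (fun _ : ℤ × ℤ => Bool))
    (hCn : ∀ a ∈ C, ∀ b, (∀ x ∉ box n, b x = a x) → b ∈ C) :
    μp (lineMinusEvt 1 m ∩ (plusOn s ∩ C)) *
        isingFV β 0 (box n) (fun _ => true) (lineMinusEvt 1 n) ≤
      μp (lineMinusEvt 1 m ∩ C) *
        isingFV β 0 (box n) (fun _ => true) (plusOn s ∩ lineMinusEvt 1 n) := by
  have hF := plusOn_mem_measurableCylinders s
  have hL := lineMinusEvt_mem_measurableCylinders 1 m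
  have hLn := lineMinusEvt_mem_measurableCylinders 1 n
  have hLFC := inter_mem_measurableCylinders hL (inter_mem_measurableCylinders hF hC)
  have hLC := inter_mem_measurableCylinders hL hC
  have hFLn := inter_mem_measurableCylinders hF hLn
  refine le_of_tendsto_of_tendsto
    (ENNReal.Tendsto.mul_const (hμp.2.tendsto_of_mem hLFC)
      (Or.inr (isingFV_ne_top β n (of_mem_measurableCylinders hLn))))
    (ENNReal.Tendsto.mul_const (hμp.2.tendsto_of_mem hLC)
      (Or.inr (isingFV_ne_top β n (of_mem_measurableCylinders hFLn))))
    (eventually_atTop.2 ⟨n, fun N hN => ?_⟩)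
  refine isingFV_mul_le hβ hN (of_mem_measurableCylinders hLFC)
    (of_mem_measurableCylinders hLn) (of_mem_measurableCylinders hLC)
    (of_mem_measurableCylinders hFLn) (fun a ha b hb hbL => ⟨fun i hi hi' => ?_, ?_⟩)
    fun a ha b hb hbL => ⟨fun x hx => ?_, fun i hi hi' => ?_⟩
  · simp [ha.1 i hi hi']
  · exact hCn a ha.2.2 _ fun x hx => by simp [hb x hx]
  · simp [ha.2.1 x hx]
  · simp [lineMinusEvt_anti hnm ha.1 i hi hi', hbL i hi hi']

lemma condLimit_cylinder_mul_le (hβ : 0 ≤ β) (hμp : IsPlusPhase β 0 μp)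
    (hμh : CylTendsto (fun m => μp[|lineMinusEvt 1 m]) μh) (s : Finset (ℤ × ℤ)) (n : ℕ)
    {C : Set Cfg2} (hC : C ∈ measurableCylinders (fun _ : ℤ × ℤ => Bool))
    (hCn : ∀ a ∈ C, ∀ b, (∀ x ∉ box n, b x = a x) → b ∈ C) :
    μh (plusOn s ∩ C) * isingFV β 0 (box n) (fun _ => true) (lineMinusEvt 1 n) ≤
      μh C * isingFV β 0 (box n) (fun _ => true) (plusOn s ∩ lineMinusEvt 1 n) := by
  have hF := plusOn_mem_measurableCylinders s
  have hLn := lineMinusEvt_mem_measurableCylinders 1 n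
  refine le_of_tendsto_of_tendsto
    (ENNReal.Tendsto.mul_const (hμh.tendsto_of_mem (inter_mem_measurableCylinders hF hC))
      (Or.inr (isingFV_ne_top β n (of_mem_measurableCylinders hLn))))
    (ENNReal.Tendsto.mul_const (hμh.tendsto_of_mem hC)
      (Or.inr (isingFV_ne_top β n
        (of_mem_measurableCylinders (inter_mem_measurableCylinders hF hLn)))))
    (eventually_atTop.2 ⟨n, fun m hm => ?_⟩)
  have hL := of_mem_measurableCylinders (lineMinusEvt_mem_measurableCylinders 1 m)
  dsimp only
  rw [cond_apply hL, cond_apply hL, mul_assoc, mul_assoc]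
  exact mul_le_mul_right (plusPhase_mul_le hβ hμp s hm hC hCn) _

lemma condLimit_mul_le (hβ : 0 ≤ β) (hμp : IsPlusPhase β 0 μp) [IsProbabilityMeasure μh]
    (hμh : CylTendsto (fun m => μp[|lineMinusEvt 1 m]) μh) (s : Finset (ℤ × ℤ)) (n : ℕ)
    {B : Set Cfg2} (hB : MeasurableSet[sigmaOn ((↑(box n) : Set (ℤ × ℤ))ᶜ)] B) :
    μh (plusOn s ∩ B) * isingFV β 0 (box n) (fun _ => true) (lineMinusEvt 1 n) ≤
      μh B * isingFV β 0 (box n) (fun _ => true) (plusOn s ∩ lineMinusEvt 1 n) := by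
  have hF := plusOn_mem_measurableCylinders s
  have hLn := lineMinusEvt_mem_measurableCylinders 1 n
  obtain ⟨B', hB', rfl⟩ := hB
  set p : Cfg2 → ((↑(box n) : Set (ℤ × ℤ))ᶜ : Set (ℤ × ℤ)) → Bool := fun η x => η x
  have hpm : Measurable p := measurable_pi_lambda _ fun x => measurable_pi_apply _
  set a := isingFV β 0 (box n) (fun _ => true) (lineMinusEvt 1 n)
  set b := isingFV β 0 (box n) (fun _ => true) (plusOn s ∩ lineMinusEvt 1 n)
  have : IsFiniteMeasure (a • (μh.restrict (plusOn s)).map p) :=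
    Measure.smul_finite _ (isingFV_ne_top β n (of_mem_measurableCylinders hLn))
  have : IsFiniteMeasure (b • μh.map p) :=
    Measure.smul_finite _
      (isingFV_ne_top β n (of_mem_measurableCylinders (inter_mem_measurableCylinders hF hLn)))
  have happ : ∀ C, MeasurableSet C → (a • (μh.restrict (plusOn s)).map p) C =
      μh (plusOn s ∩ p ⁻¹' C) * a := by
    intro C hC
    rw [Measure.smul_apply, Measure.map_apply hpm hC, Measure.restrict_apply (hpm hC),
      Set.inter_comm, smul_eq_mul, mul_comm]
  have happ' : ∀ C, MeasurableSet C → (b • μh.map p) C = μh (p ⁻¹' C) * b := by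
    intro C hC
    rw [Measure.smul_apply, Measure.map_apply hpm hC, smul_eq_mul, mul_comm]
  change μh (plusOn s ∩ p ⁻¹' B') * a ≤ μh (p ⁻¹' B') * b
  rw [← happ B' hB', ← happ' B' hB']
  refine measure_le_of_isSetAlgebra isSetAlgebra_measurableCylinders
    generateFrom_measurableCylinders.symm (fun C hC => ?_) hB'
  rw [happ C (of_mem_measurableCylinders hC), happ' C (of_mem_measurableCylinders hC)]
  refine condLimit_cylinder_mul_le hβ hμp hμh s n (preimage_restrict_mem_measurableCylinders hC)
    fun η hη η' h => ?_
  have : p η' = p η := funext fun x => h x.1 fun hx => x.2 (Finset.mem_coe.2 hx)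
  rwa [Set.mem_preimage, this]

/-- Tail events are negatively correlated with the events of being plus on a finite set. -/
lemma condLimit_plusOn_inter_le (hβ : 0 ≤ β) (hμp : IsPlusPhase β 0 μp) [IsProbabilityMeasure μh]
    (hμh : CylTendsto (fun m => μp[|lineMinusEvt 1 m]) μh) (s : Finset (ℤ × ℤ)) {B : Set Cfg2}
    (hB : ∀ N : ℕ, MeasurableSet[sigmaOn ((↑(box N) : Set (ℤ × ℤ))ᶜ)] B) :
    μh (plusOn s ∩ B) ≤ μh B * μh (plusOn s) := by
  have hF := plusOn_mem_measurableCylinders s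
  have hL := fun m => lineMinusEvt_mem_measurableCylinders 1 m
  have hbox : ∀ m n : ℕ, m ≤ n →
      μh (plusOn s ∩ B) * isingFV β 0 (box n) (fun _ => true) (lineMinusEvt 1 m) ≤
        μh B * isingFV β 0 (box n) (fun _ => true) (lineMinusEvt 1 m ∩ plusOn s) := by
    intro m n hmn
    have h₁ := condLimit_mul_le hβ hμp hμh s n (hB n)
    have h₂ : isingFV β 0 (box n) (fun _ => true) (plusOn s ∩ lineMinusEvt 1 n) *
        isingFV β 0 (box n) (fun _ => true) (lineMinusEvt 1 m) ≤
        isingFV β 0 (box n) (fun _ => true) (lineMinusEvt 1 n) *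
          isingFV β 0 (box n) (fun _ => true) (lineMinusEvt 1 m ∩ plusOn s) := by
      refine isingFV_mul_le hβ le_rfl
        (of_mem_measurableCylinders (inter_mem_measurableCylinders hF (hL n)))
        (of_mem_measurableCylinders (hL m)) (of_mem_measurableCylinders (hL n))
        (of_mem_measurableCylinders (inter_mem_measurableCylinders (hL m) hF))
        (fun a ha b _ _ i hi hi' => ?_)
        fun a ha b _ hbL => ⟨fun i hi hi' => ?_, fun x hx => ?_⟩
      · simp [ha.2 i hi hi']
      · simp [lineMinusEvt_anti hmn ha.2 i hi hi', hbL i hi hi']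
      · simp [ha.1 x hx]
    refine (ENNReal.mul_le_mul_iff_right (isingFV_lineMinusEvt_ne_zero β n)
      (isingFV_ne_top β n (of_mem_measurableCylinders (hL n)))).1 ?_
    calc isingFV β 0 (box n) (fun _ => true) (lineMinusEvt 1 n) *
          (μh (plusOn s ∩ B) * isingFV β 0 (box n) (fun _ => true) (lineMinusEvt 1 m))
        = μh (plusOn s ∩ B) * isingFV β 0 (box n) (fun _ => true) (lineMinusEvt 1 n) *
          isingFV β 0 (box n) (fun _ => true) (lineMinusEvt 1 m) := by ring
      _ ≤ μh B * isingFV β 0 (box n) (fun _ => true) (plusOn s ∩ lineMinusEvt 1 n) *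
          isingFV β 0 (box n) (fun _ => true) (lineMinusEvt 1 m) := by gcongr
      _ = μh B * (isingFV β 0 (box n) (fun _ => true) (plusOn s ∩ lineMinusEvt 1 n) *
          isingFV β 0 (box n) (fun _ => true) (lineMinusEvt 1 m)) := by ring
      _ ≤ μh B * (isingFV β 0 (box n) (fun _ => true) (lineMinusEvt 1 n) *
          isingFV β 0 (box n) (fun _ => true) (lineMinusEvt 1 m ∩ plusOn s)) := by gcongr
      _ = _ := by ring
  have hphase : ∀ m, μh (plusOn s ∩ B) * μp (lineMinusEvt 1 m) ≤
      μh B * μp (lineMinusEvt 1 m ∩ plusOn s) := fun m =>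
    le_of_tendsto_of_tendsto
      (ENNReal.Tendsto.const_mul (hμp.2.tendsto_of_mem (hL m)) (Or.inr (measure_ne_top _ _)))
      (ENNReal.Tendsto.const_mul
        (hμp.2.tendsto_of_mem (inter_mem_measurableCylinders (hL m) hF))
        (Or.inr (measure_ne_top _ _)))
      (eventually_atTop.2 ⟨m, fun n hn => hbox m n hn⟩)
  have hlim : μh (plusOn s ∩ B) * μh Set.univ ≤ μh B * μh (plusOn s) := by
    refine le_of_tendsto_of_tendsto'
      (ENNReal.Tendsto.const_mul (hμh.tendsto_of_mem (univ_mem_measurableCylinders _))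
        (Or.inr (measure_ne_top _ _)))
      (ENNReal.Tendsto.const_mul (hμh.tendsto_of_mem hF) (Or.inr (measure_ne_top _ _)))
      fun m => ?_
    rw [cond_apply (of_mem_measurableCylinders (hL m)),
      cond_apply (of_mem_measurableCylinders (hL m)), Set.inter_univ, mul_left_comm,
      mul_left_comm (μh B)]
    exact mul_le_mul_right (hphase m) _
  simpa using hlim

lemma betaCrit_nonneg : 0 ≤ betaCrit :=
  div_nonneg (Real.log_nonneg (by linarith [Real.sqrt_nonneg 2])) zero_le_two

end ConditionedMeasure

/-- Let `β > β_c`, `h = 0`, and let `μ̂` be the weak limit of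
`μ⁺(·|η(i,0) = −1, i ∈ {−m,…,−1})` as `m → ∞`. Then `μ̂` is trivial on the tail σ-algebra:
every event measurable with respect to the spins outside `[−N,N]²` for every `N` has
`μ̂`-measure `0` or `1`. -/
theorem conditioned_measure_tail_trivial
    (β : ℝ) (hβ : betaCrit < β) (μp : Measure Cfg2) (hμp : IsPlusPhase β 0 μp)
    (μh : Measure Cfg2) (hμhP : IsProbabilityMeasure μh)
    (hμh : CylTendsto (fun m => μp[|lineMinusEvt 1 m]) μh) :
    ∀ B : Set Cfg2,
      (∀ N : ℕ, MeasurableSet[sigmaOn ((↑(box N) : Set (ℤ × ℤ))ᶜ)] B) →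
      μh B = 0 ∨ μh B = 1 := by
  intro B hB
  have hβ₀ : 0 ≤ β := betaCrit_nonneg.trans hβ.le
  have hBm : MeasurableSet B := by
    obtain ⟨B', hB', rfl⟩ := hB 0
    exact (measurable_pi_lambda _ fun x => measurable_pi_apply _ :
      Measurable fun η : Cfg2 => fun x : ((↑(box 0) : Set (ℤ × ℤ))ᶜ : Set (ℤ × ℤ)) => η x) hB'
  have heq : ∀ s, μh.restrict B (plusOn s) = (μh B • μh) (plusOn s) := by
    intro s
    have hF := MeasurableSet.of_mem_measurableCylinders (plusOn_mem_measurableCylinders s)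
    have h₁ := condLimit_plusOn_inter_le hβ₀ hμp hμh s hB
    have h₂ := condLimit_plusOn_inter_le hβ₀ hμp hμh s fun N => (hB N).compl
    rw [Measure.restrict_apply hF, Measure.smul_apply, smul_eq_mul]
    refine le_antisymm h₁ ?_
    have hadd : μh (plusOn s ∩ B) + μh (plusOn s ∩ Bᶜ) =
        μh B * μh (plusOn s) + μh Bᶜ * μh (plusOn s) := by
      rw [← Set.sdiff_eq, measure_inter_add_sdiff _ hBm, ← add_mul,
        measure_add_measure_compl hBm, measure_univ, one_mul]
    refine (ENNReal.add_le_add_iff_right (measure_ne_top μh (plusOn s ∩ Bᶜ))).1 ?_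
    rw [hadd]
    gcongr
  have hself := congrArg (fun ν => ν B) (measure_ext_of_plusOn heq)
  simp only [Measure.restrict_apply hBm, Set.inter_self, Measure.smul_apply, smul_eq_mul] at hself
  by_cases h0 : μh B = 0
  · exact Or.inl h0
  · refine Or.inr ((ENNReal.mul_right_inj h0 (measure_ne_top _ _)).1 ?_)
    rw [← hself, mul_one]
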